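/- Let q be a prime power, m ≥ 1, and let w = (1, w_1, …, w_m) be a weight vector of positive integers with w_0 = 1. Let 1 ≤ d ≤ w_1 q, set d_1 = ⌊(d−1)/w_1⌋ and a_0* = d − d_1 w_1 (so 1 ≤ a_0* ≤ w_1 and d_1 ≤ q−1), and let α_1, …, α_{d_1} be distinct nonzero elements of 𝔽_q. Then the polynomial f = x_0^{a_0*} · ∏_{i=1}^{d_1} (x_1 − α_i x_0^{w_1}) is a nonzero weighted homogeneous polynomial of degree d in 𝔽_q[x_0,…,x_m]^w and |V_{ℙ(w)}(f)(𝔽_q)| = (d_1 + 1)·q^{m−1} + p_{m−2}. -/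

import Mathlib

open MvPolynomial

noncomputable section

/-- `pSum q k = 1 + q + ⋯ + q^(k-1)`; so `p_m = pSum q (m+1)`. -/
def pSum (q k : ℕ) : ℕ := ∑ i ∈ Finset.range k, q ^ i

/-- Equivalence of nonzero vectors under weighted scaling by the algebraic closure. -/
def wRel (F : Type) [Field F] {m : ℕ} (w : Fin (m + 1) → ℕ)
    (x y : {v : Fin (m + 1) → AlgebraicClosure F // v ≠ 0}) : Prop :=
  ∃ lam : (AlgebraicClosure F)ˣ, ∀ i, y.1 i = (lam : AlgebraicClosure F) ^ w i * x.1 i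

/-- The weighted projective space `ℙ(w)` as set of orbits. -/
def PW (F : Type) [Field F] {m : ℕ} (w : Fin (m + 1) → ℕ) : Type :=
  Quot (wRel F w)

def PW.mk (F : Type) [Field F] {m : ℕ} (w : Fin (m + 1) → ℕ)
    (x : {v : Fin (m + 1) → AlgebraicClosure F // v ≠ 0}) : PW F w :=
  Quot.mk _ x

/-- The `𝔽_q`-rational points of `ℙ(w)`: orbits fixed by coordinatewise Frobenius. -/
def ratPts (F : Type) [Field F] [Fintype F] {m : ℕ} (w : Fin (m + 1) → ℕ) :
    Set (PW F w) :=
  {c | ∃ x : {v : Fin (m + 1) → AlgebraicClosure F // v ≠ 0},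
    PW.mk F w x = c ∧
    ∃ h : (fun i => x.1 i ^ Fintype.card F) ≠ (0 : Fin (m + 1) → AlgebraicClosure F),
      PW.mk F w ⟨fun i => x.1 i ^ Fintype.card F, h⟩ = c}

/-- `V_{ℙ(w)}(f)(𝔽_q)`: the rational points at which `f` vanishes. -/
def vanishSet (F : Type) [Field F] [Fintype F] {m : ℕ} (w : Fin (m + 1) → ℕ)
    (f : MvPolynomial (Fin (m + 1)) F) : Set (PW F w) :=
  {c | c ∈ ratPts F w ∧ ∀ x, PW.mk F w x = c →
    MvPolynomial.eval x.1 (MvPolynomial.map (algebraMap F (AlgebraicClosure F)) f) = 0}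

/-- `e_q(d; w)`: the maximal number of rational zeroes of a nonzero
weighted homogeneous polynomial of degree `d`. -/
def eMax (F : Type) [Field F] [Fintype F] {m : ℕ} (w : Fin (m + 1) → ℕ) (d : ℕ) : ℕ :=
  sSup {n | ∃ f : MvPolynomial (Fin (m + 1)) F,
    f ≠ 0 ∧ MvPolynomial.IsWeightedHomogeneous w f d ∧ n = (vanishSet F w f).ncard}

/-- weighted degree of a monomial (exponent vector). -/
def wdeg {m : ℕ} (w : Fin (m + 1) → ℕ) (a : Fin (m + 1) →₀ ℕ) : ℕ := ∑ i, w i * a i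

/-- degree-lexicographic order (weighted degree first, `x_0 < x_1 < ⋯ < x_m`). -/
def dlexLt {m : ℕ} (w : Fin (m + 1) → ℕ) (a b : Fin (m + 1) →₀ ℕ) : Prop :=
  wdeg w a < wdeg w b ∨
    (wdeg w a = wdeg w b ∧ ∃ i, a i < b i ∧ ∀ j, i < j → a j = b j)

/-- `a` is the initial monomial of `f` for the weighted deglex order. -/
def IsInitial (F : Type) [Field F] {m : ℕ} (w : Fin (m + 1) → ℕ)
    (f : MvPolynomial (Fin (m + 1)) F) (a : Fin (m + 1) →₀ ℕ) : Prop :=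
  a ∈ f.support ∧ ∀ b ∈ f.support, b ≠ a → dlexLt w b a

/-- The vanishing ideal `I(ℙ(w)(𝔽_q))`, generated by the homogeneous polynomials
vanishing at every rational point. -/
def vanishingIdeal (F : Type) [Field F] [Fintype F] {m : ℕ} (w : Fin (m + 1) → ℕ) :
    Ideal (MvPolynomial (Fin (m + 1)) F) :=
  Ideal.span {g | (∃ e, MvPolynomial.IsWeightedHomogeneous w g e) ∧
    ∀ c ∈ ratPts F w, ∀ x, PW.mk F w x = c →
      MvPolynomial.eval x.1 (MvPolynomial.map (algebraMap F (AlgebraicClosure F)) g) = 0}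

/-- `M̄`: monomials divisible by no initial monomial of a nonzero homogeneous
element of the vanishing ideal. -/
def Mbar (F : Type) [Field F] [Fintype F] {m : ℕ} (w : Fin (m + 1) → ℕ) :
    Set (Fin (m + 1) →₀ ℕ) :=
  {a | ¬ ∃ g : MvPolynomial (Fin (m + 1)) F, g ≠ 0 ∧ g ∈ vanishingIdeal F w ∧
    (∃ e, MvPolynomial.IsWeightedHomogeneous w g e) ∧ ∃ b, IsInitial F w g b ∧ b ≤ a}

/-- `M̄_d`. -/
def MbarD (F : Type) [Field F] [Fintype F] {m : ℕ} (w : Fin (m + 1) → ℕ) (d : ℕ) :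
    Set (Fin (m + 1) →₀ ℕ) :=
  {a ∈ Mbar F w | wdeg w a = d}

/-- `M̄_{d,i}`. -/
def MbarDI (F : Type) [Field F] [Fintype F] {m : ℕ} (w : Fin (m + 1) → ℕ) (d : ℕ)
    (i : Fin (m + 1)) : Set (Fin (m + 1) →₀ ℕ) :=
  {a ∈ MbarD F w d | (∀ t, t < i → a t = 0) ∧ 1 ≤ a i}

/-- The regularity set `reg(ℙ(w)(𝔽_q)) = {d ≥ 1 : |M̄_d| = p_m}`. -/
def regSet (F : Type) [Field F] [Fintype F] {m : ℕ} (w : Fin (m + 1) → ℕ) : Set ℕ :=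
  {d | 1 ≤ d ∧ (MbarD F w d).ncard = pSum (Fintype.card F) (m + 1)}

/-- Footprint bound at level `dtil`: number of monomials of `M̄_{dtil}` divisible by `a`. -/
def FB (F : Type) [Field F] [Fintype F] {m : ℕ} (w : Fin (m + 1) → ℕ) (dtil : ℕ)
    (a : Fin (m + 1) →₀ ℕ) : ℕ :=
  {b | b ∈ MbarD F w dtil ∧ a ≤ b}.ncard

/-- `FB_i`: number of monomials of `M̄_{dtil, i}` divisible by `a`. -/
def FBi (F : Type) [Field F] [Fintype F] {m : ℕ} (w : Fin (m + 1) → ℕ) (dtil : ℕ)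
    (i : Fin (m + 1)) (a : Fin (m + 1) →₀ ℕ) : ℕ :=
  {b | b ∈ MbarDI F w dtil i ∧ a ≤ b}.ncard

/-- Hilbert function of `𝔽_q[x]/I(ℙ(w)(𝔽_q))` at degree `d`. -/
def hilb (F : Type) [Field F] [Fintype F] {m : ℕ} (w : Fin (m + 1) → ℕ) (d : ℕ) : ℕ :=
  Module.finrank F
    (↥(weightedHomogeneousSubmodule F w d) ⧸
      (Submodule.comap (weightedHomogeneousSubmodule F w d).subtype
        (Submodule.restrictScalars F (vanishingIdeal F w))))

/-- Denumerant: the number of representations `d = w0*i0 + w1*i1`. -/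
def den (w0 w1 d : ℕ) : ℕ := {p : ℕ × ℕ | w0 * p.1 + w1 * p.2 = d}.ncard


theorem aux_mk_eq (F : Type) [Field F] {m : ℕ} (w : Fin (m + 1) → ℕ)
    (x y : {v : Fin (m + 1) → AlgebraicClosure F // v ≠ 0}) :
    PW.mk F w x = PW.mk F w y ↔ wRel F w x y := by
  have he : Equivalence (wRel F w) := by
    refine ⟨fun x => ⟨1, by simp⟩, ?_, ?_⟩
    · rintro x y ⟨l, h⟩
      refine ⟨l⁻¹, fun i => ?_⟩
      rw [h i, ← mul_assoc, ← mul_pow]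
      simp
    · rintro x y z ⟨l, h⟩ ⟨l', h'⟩
      refine ⟨l' * l, fun i => ?_⟩
      rw [h' i, h i, Units.val_mul, mul_pow, mul_assoc]
  constructor
  · intro h
    exact (he.eqvGen_iff).1 (Quot.eqvGen_exact h)
  · intro h
    exact Quot.sound h

theorem aux_frob (F K : Type) [Field F] [Fintype F] [Field K] [Algebra F K] (x : K)
    (hx : x ^ Fintype.card F = x) : ∃ a : F, algebraMap F K a = x := by
  classical
  let S : Finset K := Finset.univ.image (algebraMap F K)
  let P : Polynomial K := Polynomial.X ^ Fintype.card F - Polynomial.X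
  have hP : P ≠ 0 := FiniteField.X_pow_card_sub_X_ne_zero K Fintype.one_lt_card
  have hS : S ⊆ P.roots.toFinset := by
    intro y hy
    obtain ⟨a, -, rfl⟩ := Finset.mem_image.1 hy
    rw [Multiset.mem_toFinset, Polynomial.mem_roots hP]
    simp [P, ← map_pow, FiniteField.pow_card]
  have hcard : P.roots.toFinset.card ≤ S.card := by
    rw [Finset.card_image_of_injective _ (algebraMap F K).injective, Finset.card_univ]
    refine (Multiset.toFinset_card_le _).trans ((Polynomial.card_roots' P).trans ?_)
    exact (FiniteField.X_pow_card_sub_X_natDegree_eq K Fintype.one_lt_card).le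
  have hxS : x ∈ S := by
    rw [Finset.eq_of_subset_of_card_le hS hcard, Multiset.mem_toFinset, Polynomial.mem_roots hP]
    simp [P, hx]
  obtain ⟨a, -, h⟩ := Finset.mem_image.1 hxS
  exact ⟨a, h⟩

theorem aux_fib (F K : Type) [Field F] [Field K] [Algebra F K] [IsAlgClosed K]
    {n : ℕ} (w : Fin n → ℕ) (hpos : ∀ i, 1 ≤ w i) (x : Fin n → F) (hx : x ≠ 0) :
    ∃ e : Fˣ → (Fin n → F), Function.Injective e ∧ ∀ y, y ∈ Set.range e ↔
      ∃ l : Kˣ, ∀ i, algebraMap F K (y i) = (l : K) ^ w i * algebraMap F K (x i) := by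
  classical
  let S : Finset (Fin n) := Finset.univ.filter (fun i => x i ≠ 0)
  have hS : S.Nonempty := by
    obtain ⟨i, hi⟩ := Function.ne_iff.1 hx
    exact ⟨i, by simpa [S] using hi⟩
  obtain ⟨v, hv, hv1⟩ := Finset.extract_gcd w hS
  set g := S.gcd w with hg
  have hg0 : g ≠ 0 := by
    obtain ⟨i, hi⟩ := hS
    intro h0
    have h1 := hv i hi
    have h2 := hpos i
    rw [h0, zero_mul] at h1
    omega
  refine ⟨fun μ i => (μ : F) ^ v i * x i, ?_, fun y => ⟨?_, ?_⟩⟩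
  · intro μ ν h
    have h1 : ∀ i ∈ S, (μ / ν) ^ v i = 1 := by
      intro i hi
      have hxi : x i ≠ 0 := by simpa [S] using hi
      have h2 := congrFun h i
      simp only [mul_eq_mul_right_iff, hxi, or_false] at h2
      rw [div_pow, div_eq_one]
      ext
      simpa using h2
    have h3 : orderOf (μ / ν) ∣ S.gcd v :=
      Finset.dvd_gcd fun i hi => orderOf_dvd_of_pow_eq_one (h1 i hi)
    rw [hv1, Nat.dvd_one, orderOf_eq_one_iff] at h3
    exact div_eq_one.1 h3
  · rintro ⟨μ, rfl⟩
    obtain ⟨l, hl⟩ := IsAlgClosed.exists_pow_nat_eq (algebraMap F K (μ : F)) (Nat.pos_of_ne_zero hg0)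
    have hl0 : l ≠ 0 := by
      rintro rfl
      rw [zero_pow hg0] at hl
      exact μ.ne_zero ((map_eq_zero _).1 hl.symm)
    refine ⟨Units.mk0 l hl0, fun i => ?_⟩
    by_cases hi : x i = 0
    · simp [hi]
    · rw [hv i (by simpa [S] using hi), Units.val_mk0, pow_mul, hl]
      simp
  · rintro ⟨l, hl⟩
    let H : Subgroup Kˣ := (Units.map (algebraMap F K : F →* K)).range
    have h1 : ∀ i ∈ S, ((l : Kˣ ⧸ H)) ^ w i = 1 := by
      intro i hi
      have hxi : x i ≠ 0 := by simpa [S] using hi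
      have hKx : algebraMap F K (x i) ≠ 0 := by simpa using hxi
      have hyi : y i ≠ 0 := by
        intro h0
        have := hl i
        rw [h0, map_zero] at this
        exact (mul_ne_zero (pow_ne_zero _ l.ne_zero) hKx) this.symm
      rw [← QuotientGroup.mk_pow, QuotientGroup.eq_one_iff]
      refine ⟨Units.mk0 (y i / x i) (div_ne_zero hyi hxi), ?_⟩
      ext
      simp [hl i, hxi]
    have h2 : orderOf (l : Kˣ ⧸ H) ∣ g :=
      Finset.dvd_gcd fun i hi => orderOf_dvd_of_pow_eq_one (h1 i hi)
    have h3 := orderOf_dvd_iff_pow_eq_one.1 h2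
    rw [← QuotientGroup.mk_pow, QuotientGroup.eq_one_iff] at h3
    obtain ⟨μ, hμ⟩ := h3
    have hμ' : algebraMap F K (μ : F) = (l : K) ^ g := by
      simpa using congrArg Units.val hμ
    refine ⟨μ, funext fun i => (algebraMap F K).injective ?_⟩
    rw [hl i]
    by_cases hi : x i = 0
    · simp [hi]
    · rw [hv i (by simpa [S] using hi), pow_mul, ← hμ']
      simp

/-- The point of the weighted projective space attached to a nonzero vector over `F`. -/
def auxEmb (F : Type) [Field F] {m : ℕ} (w : Fin (m + 1) → ℕ)
    (x : {v : Fin (m + 1) → F // v ≠ 0}) : PW F w :=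
  PW.mk F w ⟨fun i => algebraMap F (AlgebraicClosure F) (x.1 i), by
    intro h
    refine x.2 (funext fun i => ?_)
    simpa using congrFun h i⟩

theorem aux_surj (F : Type) [Field F] [Fintype F] {m : ℕ} (w : Fin (m + 1) → ℕ)
    (c : PW F w) (hc : c ∈ ratPts F w) : ∃ x, auxEmb F w x = c := by
  obtain ⟨x, rfl, h, h'⟩ := hc
  obtain ⟨l, hl⟩ := (aux_mk_eq F w _ _).1 h'
  simp only at hl
  have hq : 0 < Fintype.card F - 1 := by
    have := Fintype.one_lt_card (α := F)
    omega
  obtain ⟨μ, hμ⟩ := IsAlgClosed.exists_pow_nat_eq ((l : AlgebraicClosure F)) hq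
  have hμ0 : μ ≠ 0 := by
    rintro rfl
    rw [zero_pow hq.ne'] at hμ
    exact l.ne_zero hμ.symm
  have hfix : ∀ i, (μ ^ w i * x.1 i) ^ Fintype.card F = μ ^ w i * x.1 i := by
    intro i
    have hq1 : Fintype.card F = (Fintype.card F - 1) + 1 := by omega
    have h2 : μ ^ Fintype.card F = (l : AlgebraicClosure F) * μ := by
      rw [← hμ, ← pow_succ, ← hq1]
    rw [mul_pow, ← pow_mul, mul_comm (w i), pow_mul, h2, mul_pow]
    conv_rhs => rw [hl i]
    ring
  choose a ha using fun i => aux_frob F (AlgebraicClosure F) _ (hfix i)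
  have ha0 : a ≠ 0 := by
    rintro rfl
    refine x.2 (funext fun i => ?_)
    have := ha i
    simp only [Pi.zero_apply, map_zero] at this
    rcases mul_eq_zero.1 this.symm with h | h
    · exact absurd h (pow_ne_zero _ hμ0)
    · exact h
  refine ⟨⟨a, ha0⟩, ((aux_mk_eq F w _ _).2 ⟨Units.mk0 μ hμ0, fun i => ?_⟩).symm⟩
  simp [ha]

theorem aux_emb_rat (F : Type) [Field F] [Fintype F] {m : ℕ} (w : Fin (m + 1) → ℕ)
    (x) : auxEmb F w x ∈ ratPts F w := by
  have h : (fun i => algebraMap F (AlgebraicClosure F) (x.1 i) ^ Fintype.card F) =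
      fun i => algebraMap F (AlgebraicClosure F) (x.1 i) := by
    funext i
    rw [← map_pow, FiniteField.pow_card]
  refine ⟨_, rfl, ?_, ?_⟩
  · simp only [h]
    intro h
    refine x.2 (funext fun i => ?_)
    simpa using congrFun h i
  · simp only [h]
    rfl

theorem aux_count (F : Type) [Field F] [Fintype F] {m : ℕ} (w : Fin (m + 1) → ℕ)
    (hpos : ∀ i, 1 ≤ w i) (V : Set (PW F w)) (hV : V ⊆ ratPts F w) :
    V.ncard * (Fintype.card F - 1) = Nat.card {x // auxEmb F w x ∈ V} := by
  classical
  have key : ∀ c : V, Nonempty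
      ({x : {x // auxEmb F w x ∈ V} // (⟨auxEmb F w x.1, x.2⟩ : V) = c} ≃ Fˣ) := by
    rintro ⟨c, hc⟩
    obtain ⟨x, rfl⟩ := aux_surj F w c (hV hc)
    obtain ⟨e, he, hr⟩ := aux_fib F (AlgebraicClosure F) w hpos x.1 x.2
    have hiff : ∀ y, auxEmb F w y = auxEmb F w x ↔ y.1 ∈ Set.range e := by
      intro y
      rw [hr, eq_comm]
      exact aux_mk_eq F w _ _
    have hne : ∀ μ, e μ ≠ 0 := by
      intro μ h0
      obtain ⟨l, hl⟩ := (hr (e μ)).1 ⟨μ, rfl⟩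
      refine x.2 (funext fun i => ?_)
      have := hl i
      simpa [h0] using this
    have hm : ∀ μ, auxEmb F w ⟨e μ, hne μ⟩ = auxEmb F w x := fun μ => (hiff _).2 ⟨μ, rfl⟩
    refine ⟨(Equiv.ofBijective (fun μ => ⟨⟨⟨e μ, hne μ⟩, by rw [hm μ]; exact hc⟩,
      Subtype.ext (hm μ)⟩) ⟨?_, ?_⟩).symm⟩
    · intro μ ν h
      simp only [Subtype.mk.injEq] at h
      exact he h
    · rintro ⟨⟨y, hy⟩, h⟩
      obtain ⟨μ, hμ⟩ := (hiff y).1 (congrArg Subtype.val h)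
      refine ⟨μ, ?_⟩
      apply Subtype.ext
      apply Subtype.ext
      apply Subtype.ext
      exact hμ
  let E := (Equiv.sigmaFiberEquiv (fun x : {x // auxEmb F w x ∈ V} =>
      (⟨auxEmb F w x.1, x.2⟩ : V))).symm.trans
    ((Equiv.sigmaCongrRight fun c => (key c).some).trans (Equiv.sigmaEquivProd V Fˣ))
  rw [Nat.card_congr E, Nat.card_prod, Nat.card_eq_fintype_card (α := Fˣ), Fintype.card_units]
  rfl

theorem aux_zeros (F : Type) [Field F] [Fintype F] (k W d1 : ℕ)
    (α : Fin d1 → F) (hinj : Function.Injective α) :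
    Nat.card {x : {v : Fin (k + 2) → F // v ≠ 0} //
      x.1 0 = 0 ∨ ∃ i, x.1 1 = α i * x.1 0 ^ W} + 1 =
      (Fintype.card F + (Fintype.card F - 1) * d1) * Fintype.card F ^ k := by
  classical
  let P : (Fin (k + 2) → F) → Prop := fun v => v 0 = 0 ∨ ∃ i, v 1 = α i * v 0 ^ W
  let T : Finset (F × F) := Finset.univ.filter (fun p => p.1 = 0 ∨ ∃ i, p.2 = α i * p.1 ^ W)
  have hT : T.card = Fintype.card F + (Fintype.card F - 1) * d1 := by
    let A : Finset (F × F) := Finset.univ.image (fun y : F => ((0 : F), y))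
    let B : Finset (F × F) := Finset.univ.image
      (fun y : Fˣ × Fin d1 => ((y.1 : F), α y.2 * (y.1 : F) ^ W))
    have hAB : T = A ∪ B := by
      ext ⟨a, b⟩
      simp only [T, A, B, Finset.mem_filter, Finset.mem_union, Finset.mem_image,
        Finset.mem_univ, true_and, Prod.mk.injEq, exists_eq_right, Prod.exists]
      constructor
      · rintro (rfl | ⟨i, hi⟩)
        · simp
        · by_cases ha : a = 0
          · simp [ha]
          · right
            exact ⟨Units.mk0 a ha, i, rfl, by simp [hi]⟩
      · rintro (⟨_, rfl, _⟩ | ⟨u, i, rfl, rfl⟩)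
        · simp
        · right
          exact ⟨i, rfl⟩
    have hd : Disjoint A B := by
      rw [Finset.disjoint_left]
      intro p hp hq
      obtain ⟨y, -, rfl⟩ := Finset.mem_image.1 hp
      obtain ⟨z, -, hz⟩ := Finset.mem_image.1 hq
      exact z.1.ne_zero (congrArg Prod.fst hz)
    rw [hAB, Finset.card_union_of_disjoint hd, Finset.card_image_of_injective,
      Finset.card_image_of_injective]
    · simp [Fintype.card_units]
    · rintro ⟨u, i⟩ ⟨v, j⟩ h
      simp only [Prod.mk.injEq] at h
      obtain ⟨h1, h2⟩ := h
      have h3 : u = v := Units.ext h1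
      subst h3
      have h4 := mul_right_cancel₀ (pow_ne_zero _ u.ne_zero) h2
      rw [hinj h4]
    · intro a b h
      simpa using h
  have hN : Nat.card {v // P v} = T.card * Fintype.card F ^ k := by
    have E : {v // P v} ≃ T × (Fin k → F) :=
      { toFun := fun v => (⟨(v.1 0, v.1 1), by simpa [T] using v.2⟩, fun i => v.1 i.succ.succ)
        invFun := fun p => ⟨Fin.cons p.1.1.1 (Fin.cons p.1.1.2 p.2), by
          have := p.1.2
          simp only [T, Finset.mem_filter] at this
          exact this.2⟩
        left_inv := by
          rintro ⟨v, hv⟩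
          apply Subtype.ext
          funext i
          refine Fin.cases rfl (fun j => ?_) i
          refine Fin.cases rfl (fun j => rfl) j
        right_inv := by
          rintro ⟨⟨⟨a, b⟩, h⟩, c⟩
          rfl }
    rw [Nat.card_congr E, Nat.card_prod]
    simp
  rw [← hT, ← hN]
  have hP0 : P 0 := Or.inl rfl
  have E2 : {x : {v : Fin (k + 2) → F // v ≠ 0} // P x.1} ≃ {y : {v // P v} // y ≠ ⟨0, hP0⟩} :=
    { toFun := fun x => ⟨⟨x.1.1, x.2⟩, fun h => x.1.2 (congrArg Subtype.val h)⟩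
      invFun := fun y => ⟨⟨y.1.1, fun h => y.2 (Subtype.ext h)⟩, y.1.2⟩
      left_inv := fun _ => rfl
      right_inv := fun _ => rfl }
  have h5 := Nat.card_congr E2
  have h6 : Nat.card {y : {v // P v} // y ≠ ⟨0, hP0⟩} = Nat.card {v // P v} - 1 := by
    rw [Nat.card_eq_fintype_card, Nat.card_eq_fintype_card, Fintype.card_subtype_compl]
    simp
  have h7 : 0 < Nat.card {v // P v} := by
    have : Nonempty {v // P v} := ⟨⟨0, hP0⟩⟩
    exact Nat.card_pos
  change Nat.card {x : {v : Fin (k + 2) → F // v ≠ 0} // P x.1} + 1 = _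
  omega

/-- the explicit polynomial attaining the bound for `1 ≤ d ≤ w_1 q`. -/
theorem stmt2 (F : Type) [Field F] [Fintype F] (m : ℕ) (hm : 1 ≤ m)
    (w : Fin (m + 1) → ℕ) (hpos : ∀ i, 1 ≤ w i) (hw0 : w ⟨0, by omega⟩ = 1)
    (d : ℕ) (hd1 : 1 ≤ d) (hdq : d ≤ w ⟨1, by omega⟩ * Fintype.card F)
    (d1 a0s : ℕ) (hd1def : d1 = (d - 1) / w ⟨1, by omega⟩)
    (ha0s : a0s = d - d1 * w ⟨1, by omega⟩)
    (α : Fin d1 → F) (hinj : Function.Injective α) (hne : ∀ i, α i ≠ 0)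
    (f : MvPolynomial (Fin (m + 1)) F)
    (hf : f = X ⟨0, by omega⟩ ^ a0s *
      ∏ i : Fin d1,
        (X ⟨1, by omega⟩ - C (α i) * X ⟨0, by omega⟩ ^ w ⟨1, by omega⟩)) :
    f ≠ 0 ∧ MvPolynomial.IsWeightedHomogeneous w f d ∧
      (vanishSet F w f).ncard =
        (d1 + 1) * Fintype.card F ^ (m - 1) + pSum (Fintype.card F) (m - 1) := by
  obtain ⟨k, rfl⟩ : ∃ k, m = k + 1 := ⟨m - 1, by omega⟩
  have e0 : (⟨0, by omega⟩ : Fin (k + 1 + 1)) = 0 := rfl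
  have e1 : (⟨1, by omega⟩ : Fin (k + 1 + 1)) = 1 := rfl
  simp only [e0, e1] at *
  have hW := hpos 1
  set W := w 1 with hWdef
  have hle : d1 * W ≤ d - 1 := by
    rw [hd1def]
    exact Nat.div_mul_le_self _ _
  have ha : a0s ≠ 0 := by omega
  have hne0 : f ≠ 0 := by
    rw [hf]
    refine mul_ne_zero (pow_ne_zero _ (X_ne_zero _)) (Finset.prod_ne_zero_iff.2 fun i _ h => ?_)
    have := congrArg (MvPolynomial.eval (fun j : Fin (k + 1 + 1) => if j = 1 then (1 : F) else 0)) h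
    simp [show W ≠ 0 by omega] at this
  have hhom : MvPolynomial.IsWeightedHomogeneous w f d := by
    have h0 : MvPolynomial.IsWeightedHomogeneous w (X 0 ^ a0s : MvPolynomial (Fin (k + 1 + 1)) F)
        (a0s • 1) := by
      have := (isWeightedHomogeneous_X F w 0).pow a0s
      rwa [hw0] at this
    have h1 : ∀ i ∈ Finset.univ, MvPolynomial.IsWeightedHomogeneous w
        (X 1 - C (α i) * X 0 ^ W : MvPolynomial (Fin (k + 1 + 1)) F) W := by
      intro i _
      refine (isWeightedHomogeneous_X F w 1).sub ?_
      have := (isWeightedHomogeneous_C w (α i)).mul ((isWeightedHomogeneous_X F w 0).pow W)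
      rwa [hw0, zero_add, smul_eq_mul, mul_one] at this
    have h2 := h0.mul (IsWeightedHomogeneous.prod Finset.univ _ (fun _ => W) h1)
    rw [hf]
    convert h2 using 1
    simp
    omega
  refine ⟨hne0, hhom, ?_⟩
  have hev : ∀ x : Fin (k + 1 + 1) → AlgebraicClosure F,
      MvPolynomial.eval x (MvPolynomial.map (algebraMap F (AlgebraicClosure F)) f) = 0 ↔
      x 0 = 0 ∨ ∃ i, x 1 = algebraMap F (AlgebraicClosure F) (α i) * x 0 ^ W := by
    intro x
    rw [hf]
    simp [Finset.prod_eq_zero_iff, ha, sub_eq_zero]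
  have hmem : ∀ x, auxEmb F w x ∈ vanishSet F w f ↔
      (x.1 0 = 0 ∨ ∃ i, x.1 1 = α i * x.1 0 ^ W) := by
    intro x
    constructor
    · rintro ⟨-, h⟩
      have := (hev _).1 (h _ rfl)
      simp only [map_eq_zero, ← map_pow, ← map_mul, (algebraMap F (AlgebraicClosure F)).injective.eq_iff] at this
      exact this
    · intro h
      refine ⟨aux_emb_rat F w x, fun y hy => (hev _).2 ?_⟩
      obtain ⟨l, hl⟩ := (aux_mk_eq F w _ _).1 hy.symm
      have h0 := hl 0
      have h1 := hl 1
      rw [hw0, pow_one] at h0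
      simp only at h0 h1
      rcases h with h | ⟨i, h⟩
      · left
        rw [h0, h]
        simp
      · right
        refine ⟨i, ?_⟩
        rw [h0, h1, h, ← hWdef, map_mul, map_pow]
        ring
  have hc := aux_count F w hpos (vanishSet F w f) (fun c hc => hc.1)
  rw [Nat.card_congr (Equiv.subtypeEquivRight hmem)] at hc
  have hz := aux_zeros F k W d1 α hinj
  rw [← hc] at hz
  obtain ⟨r, hr⟩ : ∃ r, Fintype.card F = r + 2 :=
    ⟨Fintype.card F - 2, by have := Fintype.one_lt_card (α := F); omega⟩
  simp only [Nat.add_sub_cancel]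
  rw [hr] at hz ⊢
  have hp : pSum (r + 2) k * (r + 1) + 1 = (r + 2) ^ k := by
    have := geom_sum_mul_add (r + 1) k
    exact this
  have hs : r + 2 - 1 = r + 1 := rfl
  rw [hs] at hz
  have : (vanishSet F w f).ncard * (r + 1) =
      ((d1 + 1) * (r + 2) ^ k + pSum (r + 2) k) * (r + 1) := by
    have hz' : (vanishSet F w f).ncard * (r + 1) + 1 =
      ((d1 + 1) * (r + 2) ^ k + pSum (r + 2) k) * (r + 1) + 1 := by
      rw [hz, add_mul _ (pSum _ _), add_assoc (_ * _), hp]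
      ring
    omega
  exact Nat.eq_of_mul_eq_mul_right (Nat.succ_pos r) this

end
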